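/- (Riesz–Frechet representation theorem in Riesz spaces) For each 𝔣 ∈ Ê there exists y(𝔣) ∈ E := L²(T) such that 𝔣(g) = T(g·y(𝔣)) for all g ∈ E, i.e. 𝔣 = T_{y(𝔣)}. -/

import Mathlib

/-- `p` is a component of the weak order unit `e`: `0 ≤ p ≤ e` and `p ∧ (e - p) = 0`. -/
def IsComponent {E : Type*} [AddCommGroup E] [Lattice E] (e p : E) : Prop :=
  0 ≤ p ∧ p ≤ e ∧ p ⊓ (e - p) = 0

/-- The setting of the Riesz-Frechet representation theorem, formulated inside the
universal completion `U = E_u` with its `f`-algebra structure whose multiplicative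
unit `1` is the chosen weak order unit `e` (with `Te = e`).  `L1` is the
`T`-universally complete space `E = L¹(T)`, `RT` is the range `R(T)` of the strictly
positive conditional expectation operator `T`, and `sqrt` is the (unique positive)
square root in the universally complete `f`-algebra `R(T)`. -/
structure CESetup (U : Type*) [CommRing U] [ConditionallyCompleteLattice U]
    [CovariantClass U U (· + ·) (· ≤ ·)] [Module ℝ U] [PosSMulMono ℝ U] where
  /-- `E = L¹(T)`, the natural domain of `T` -/
  L1 : Set U
  /-- `R(T)`, the range of `T` -/
  RT : Set U
  /-- the strictly positive conditional expectation operator -/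
  T : U → U
  /-- the square root in the universally complete `f`-algebra -/
  sqrt : U → U
  /-- `U` is an `f`-algebra: products of positives are positive -/
  mul_nonneg : ∀ x y : U, 0 ≤ x → 0 ≤ y → 0 ≤ x * y
  /-- `U` is an `f`-algebra: `x ⊓ y = 0` implies `(x z) ⊓ y = 0` for `z ≥ 0` -/
  falg : ∀ x y z : U, x ⊓ y = 0 → 0 ≤ z → (x * z) ⊓ y = 0
  one_pos : (0 : U) < 1
  /-- `e = 1` is a weak order unit -/
  one_weak : ∀ x : U, 0 ≤ x → x ⊓ 1 = 0 → x = 0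
  /-- `L¹(T)` is a Riesz subspace, in fact an order ideal, of `U` -/
  L1_zero : (0 : U) ∈ L1
  L1_add : ∀ x ∈ L1, ∀ y ∈ L1, x + y ∈ L1
  L1_smul : ∀ (c : ℝ), ∀ x ∈ L1, c • x ∈ L1
  L1_ideal : ∀ x : U, ∀ y ∈ L1, |x| ≤ |y| → x ∈ L1
  L1_one : (1 : U) ∈ L1
  /-- `L¹(T)` is an `R(T)`-module -/
  L1_module : ∀ r ∈ RT, ∀ x ∈ L1, r * x ∈ L1
  /-- `R(T)` is a Riesz subspace and subalgebra of `U`, contained in `L¹(T)` -/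
  RT_sub : RT ⊆ L1
  RT_zero : (0 : U) ∈ RT
  RT_one : (1 : U) ∈ RT
  RT_add : ∀ x ∈ RT, ∀ y ∈ RT, x + y ∈ RT
  RT_neg : ∀ x ∈ RT, -x ∈ RT
  RT_smul : ∀ (c : ℝ), ∀ x ∈ RT, c • x ∈ RT
  RT_mul : ∀ x ∈ RT, ∀ y ∈ RT, x * y ∈ RT
  RT_sup : ∀ x ∈ RT, ∀ y ∈ RT, x ⊔ y ∈ RT
  /-- `R(T)` is order closed in `U` -/
  RT_orderClosed : ∀ S ⊆ RT, S.Nonempty → BddAbove S → sSup S ∈ RT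
  /-- `T` is linear on `L¹(T)` -/
  T_add : ∀ x ∈ L1, ∀ y ∈ L1, T (x + y) = T x + T y
  T_smul : ∀ (c : ℝ), ∀ x ∈ L1, T (c • x) = c • T x
  /-- `T` is positive -/
  T_pos : ∀ x ∈ L1, 0 ≤ x → 0 ≤ T x
  /-- `T` is strictly positive -/
  T_strict : ∀ x ∈ L1, 0 ≤ x → T x = 0 → x = 0
  /-- `T` maps into `R(T)` -/
  T_mem : ∀ x ∈ L1, T x ∈ RT
  /-- `T` is a projection onto `R(T)` -/
  T_fix : ∀ r ∈ RT, T r = r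
  /-- `T e = e` for the weak order unit `e = 1` -/
  T_one : T 1 = 1
  /-- `T` is an averaging operator: `T(rg) = r T(g)` for `r ∈ R(T)`, `g ∈ L¹(T)` -/
  T_avg : ∀ r ∈ RT, ∀ g ∈ L1, T (r * g) = r * T g
  /-- `T` is order continuous -/
  T_ordCont : ∀ S ⊆ L1, S.Nonempty → DirectedOn (· ≥ ·) S → (∀ x ∈ S, 0 ≤ x) →
    sInf S = 0 → sInf (T '' S) = 0
  /-- `E` is `T`-universally complete, `E = L¹(T)`: every upward directed set of
  positive elements of `L¹(T)` whose `T`-image is order bounded has a supremum,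
  which lies in `L¹(T)` -/
  T_univComplete : ∀ S ⊆ L1, S.Nonempty → DirectedOn (· ≤ ·) S → (∀ x ∈ S, 0 ≤ x) →
    (∃ b : U, ∀ x ∈ S, T x ≤ b) → BddAbove S ∧ sSup S ∈ L1
  /-- properties of the square root -/
  sqrt_nonneg : ∀ x : U, 0 ≤ sqrt x
  sqrt_sq : ∀ x : U, 0 ≤ x → sqrt x * sqrt x = x
  sqrt_mem : ∀ x ∈ RT, 0 ≤ x → sqrt x ∈ RT

namespace CESetup

variable {U : Type*} [CommRing U] [ConditionallyCompleteLattice U]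
  [CovariantClass U U (· + ·) (· ≤ ·)] [Module ℝ U] [PosSMulMono ℝ U]

/-- `E = L²(T) = {f ∈ L¹(T) : f² ∈ L¹(T)}`. -/
def L2 (s : CESetup U) : Set U := {f | f ∈ s.L1 ∧ f * f ∈ s.L1}

/-- The `R(T)`-valued norm `‖f‖_{T,2} = (T(f²))^{1/2}` on `L²(T)`. -/
noncomputable def norm2 (s : CESetup U) (f : U) : U := s.sqrt (s.T (f * f))

/-- `F` is a `T`-linear functional on `E = L²(T)`: an additive, `R(T)`-homogeneous,
order continuous map `E → R(T)`. -/
def IsTLinear (s : CESetup U) (F : U → U) : Prop :=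
  (∀ f ∈ s.L2, F f ∈ s.RT) ∧
  (∀ f ∈ s.L2, ∀ g ∈ s.L2, F (f + g) = F f + F g) ∧
  (∀ r ∈ s.RT, ∀ f ∈ s.L2, F (r * f) = r * F f) ∧
  (∀ S ⊆ s.L2, S.Nonempty → DirectedOn (· ≥ ·) S → (∀ x ∈ S, 0 ≤ x) → sInf S = 0 →
    ∃ w : U → U, (∀ p ∈ S, ∀ q ∈ S, p ≤ q → w p ≤ w q) ∧ sInf (w '' S) = 0 ∧
      ∀ p ∈ S, |F p| ≤ w p)

/-- `F` is `T`-strongly bounded: `|F(g)| ≤ k ‖g‖_{T,2}` for some `k ∈ R(T)⁺`.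
The `T`-strong dual `Ê` consists of the `T`-strongly bounded `T`-linear functionals. -/
def IsStronglyBounded (s : CESetup U) (F : U → U) : Prop :=
  ∃ k ∈ s.RT, 0 ≤ k ∧ ∀ g ∈ s.L2, |F g| ≤ k * s.norm2 g

/-- The `R(T)`-valued norm on the `T`-strong dual `Ê`:
`‖F‖ = inf {k ∈ R(T)⁺ : |F(g)| ≤ k ‖g‖_{T,2} for all g}`. -/
noncomputable def opNorm (s : CESetup U) (F : U → U) : U :=
  sInf {k | k ∈ s.RT ∧ 0 ≤ k ∧ ∀ g ∈ s.L2, |F g| ≤ k * s.norm2 g}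

end CESetup

namespace CESetup

section

variable {U : Type*} [CommRing U] [ConditionallyCompleteLattice U] [IsOrderedRing U]

/-- A conditionally complete lattice-ordered ring is Archimedean. -/
theorem nonpos_of_forall_natCast_mul_le {x c : U} (h : ∀ n : ℕ, 0 < n → n * x ≤ c) : x ≤ 0 := by
  let S : Set U := {y | ∃ n : ℕ, 0 < n ∧ y = n * x}
  have hS : BddAbove S := ⟨c, by rintro _ ⟨n, hn, rfl⟩; exact h n hn⟩
  have hne : S.Nonempty := ⟨_, 1, Nat.one_pos, rfl⟩
  have key : sSup S ≤ sSup S - x := by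
    refine csSup_le hne ?_
    rintro _ ⟨n, hn, rfl⟩
    have h1 : ((n + 1 : ℕ) : U) * x ≤ sSup S := le_csSup hS ⟨n + 1, n.succ_pos, rfl⟩
    push_cast at h1
    linear_combination h1
  linear_combination key

variable [Module ℝ U] [PosSMulMono ℝ U]

theorem posPart_mul_negPart (s : CESetup U) (x : U) : x⁺ * x⁻ = 0 := by
  have h1 := s.falg _ _ x⁻ (posPart_inf_negPart_eq_zero x) (negPart_nonneg x)
  have h2 := s.falg _ _ x⁺ (inf_comm _ _ |>.trans h1) (posPart_nonneg x)
  rwa [mul_comm, inf_idem] at h2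

theorem mul_self_eq_posPart_add_negPart (s : CESetup U) (x : U) : x * x = x⁺ * x⁺ + x⁻ * x⁻ := by
  conv_lhs => rw [← posPart_sub_negPart x]
  linear_combination (-2) * s.posPart_mul_negPart x

theorem mul_self_nonneg (s : CESetup U) (x : U) : 0 ≤ x * x := by
  rw [s.mul_self_eq_posPart_add_negPart]
  exact add_nonneg (_root_.mul_nonneg (posPart_nonneg x) (posPart_nonneg x))
    (_root_.mul_nonneg (negPart_nonneg x) (negPart_nonneg x))

theorem eq_zero_of_mul_self_eq_zero (s : CESetup U) {p : U} (hp : 0 ≤ p) (h : p * p = 0) :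
    p = 0 := by
  refine le_antisymm (nonpos_of_forall_natCast_mul_le (c := 1) fun n _ => ?_) hp
  have h1 := s.mul_self_nonneg (1 - n * p)
  have h2 : (0 : U) ≤ n * p := _root_.mul_nonneg (Nat.cast_nonneg n) hp
  linear_combination h1 + h2 + (n : U) ^ 2 * h

theorem natCast_mem_RT (s : CESetup U) (n : ℕ) : (n : U) ∈ s.RT := by
  induction n with
  | zero => simpa using s.RT_zero
  | succ n ih => simpa using s.RT_add _ ih _ s.RT_one

theorem exists_natCast_mul_eq_one (s : CESetup U) {n : ℕ} (hn : 0 < n) :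
    ∃ t ∈ s.RT, 0 ≤ t ∧ (n : U) * t = 1 := by
  refine ⟨(1 / n : ℝ) • 1, s.RT_smul _ _ s.RT_one, smul_nonneg (by positivity) s.one_pos.le, ?_⟩
  rw [← nsmul_eq_mul, ← Nat.cast_smul_eq_nsmul ℝ, smul_smul, mul_one_div_cancel (by positivity),
    one_smul]

theorem le_of_natCast_mul_le (s : CESetup U) {n : ℕ} (hn : 0 < n) {c d : U}
    (h : n * c ≤ n * d) : c ≤ d := by
  obtain ⟨t, -, ht, h1⟩ := s.exists_natCast_mul_eq_one hn
  linear_combination t * h + (d - c) * h1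

theorem isGLB_mul_image (s : CESetup U) {D : Set U} {w z : U}
    (hD0 : ∀ u ∈ D, 0 ≤ u ∧ u ≤ w) (hglb : IsGLB D 0) (hz : 0 ≤ z) :
    IsGLB ((fun u => z * u) '' D) 0 := by
  refine ⟨?_, ?_⟩
  · rintro _ ⟨u, hu, rfl⟩
    exact _root_.mul_nonneg hz (hD0 u hu).1
  · intro c hc
    refine s.le_of_natCast_mul_le two_pos ?_
    rw [mul_zero]
    refine nonpos_of_forall_natCast_mul_le (c := z * z * w) fun n hn => ?_
    obtain ⟨t, -, ht, h1⟩ := s.exists_natCast_mul_eq_one hn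
    have h2 : t * t * (n * (2 * c) - z * z * w) ≤ 0 := by
      refine hglb.2 fun u hu => ?_
      have h3 : c ≤ z * u := hc ⟨u, hu, rfl⟩
      have h4 : 0 ≤ (n - z) * (n - z) * u := _root_.mul_nonneg (s.mul_self_nonneg _) (hD0 u hu).1
      have h5 : 0 ≤ z * z * (w - u) :=
        _root_.mul_nonneg (s.mul_self_nonneg _) (sub_nonneg.2 (hD0 u hu).2)
      have h6 : n * (2 * c) - z * z * w ≤ n * n * u := by
        linear_combination h4 + h5 + (n : U) * h3 + (n : U) * h3
      linear_combination t * t * h6 + (n * t + 1) * u * h1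
    have hn0 : (0 : U) ≤ n := Nat.cast_nonneg n
    have h7 := _root_.mul_nonneg (_root_.mul_nonneg hn0 hn0) (sub_nonneg.2 h2)
    push_cast
    linear_combination h7 - (n * t + 1) * (n * (2 * c) - z * z * w) * h1

/-! ### `L¹(T)` and `L²(T)` -/

variable (s : CESetup U)

theorem mem_L1_of_le {x y : U} (hx : 0 ≤ x) (hxy : x ≤ y) (hy : y ∈ s.L1) : x ∈ s.L1 :=
  s.L1_ideal x y hy (by rwa [abs_of_nonneg hx, abs_of_nonneg (hx.trans hxy)])

theorem neg_mem_L1 {x : U} (hx : x ∈ s.L1) : -x ∈ s.L1 := s.L1_ideal _ x hx (by rw [abs_neg])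

theorem sub_mem_L1 {x y : U} (hx : x ∈ s.L1) (hy : y ∈ s.L1) : x - y ∈ s.L1 := by
  rw [sub_eq_add_neg]; exact s.L1_add _ hx _ (s.neg_mem_L1 hy)

theorem T_sub {x y : U} (hx : x ∈ s.L1) (hy : y ∈ s.L1) : s.T (x - y) = s.T x - s.T y := by
  have h := s.T_add _ (s.sub_mem_L1 hx hy) _ hy
  rw [sub_add_cancel] at h
  rw [h, add_sub_cancel_right]

theorem T_mono {x y : U} (hx : x ∈ s.L1) (hy : y ∈ s.L1) (h : x ≤ y) : s.T x ≤ s.T y := by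
  rw [← sub_nonneg, ← s.T_sub hy hx]
  exact s.T_pos _ (s.sub_mem_L1 hy hx) (sub_nonneg.2 h)

theorem mul_mem_L1 {x y : U} (hx : x ∈ s.L2) (hy : y ∈ s.L2) : x * y ∈ s.L1 := by
  obtain ⟨t, ht, ht0, h1⟩ := s.exists_natCast_mul_eq_one two_pos
  push_cast at h1
  have hs : x * x + y * y ∈ s.L1 := s.L1_add _ hx.2 _ hy.2
  have hs0 : 0 ≤ x * x + y * y := add_nonneg (s.mul_self_nonneg x) (s.mul_self_nonneg y)
  have h2 : 2 * (x * y) ∈ s.L1 := by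
    refine s.L1_ideal _ _ hs ?_
    rw [abs_of_nonneg hs0, abs_le']
    exact ⟨by linear_combination s.mul_self_nonneg (x - y),
      by linear_combination s.mul_self_nonneg (x + y)⟩
  have h3 := s.L1_module t ht _ h2
  rwa [show t * (2 * (x * y)) = x * y by linear_combination x * y * h1] at h3

theorem add_mem_L2 {x y : U} (hx : x ∈ s.L2) (hy : y ∈ s.L2) : x + y ∈ s.L2 := by
  refine ⟨s.L1_add _ hx.1 _ hy.1, ?_⟩
  rw [show (x + y) * (x + y) = x * x + x * y + (x * y + y * y) by ring]
  exact s.L1_add _ (s.L1_add _ hx.2 _ (s.mul_mem_L1 hx hy)) _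
    (s.L1_add _ (s.mul_mem_L1 hx hy) _ hy.2)

theorem RT_mul_mem_L2 {r x : U} (hr : r ∈ s.RT) (hx : x ∈ s.L2) : r * x ∈ s.L2 := by
  refine ⟨s.L1_module r hr _ hx.1, ?_⟩
  rw [show r * x * (r * x) = r * (r * (x * x)) by ring]
  exact s.L1_module r hr _ (s.L1_module r hr _ hx.2)

theorem neg_one_mem_RT : (-1 : U) ∈ s.RT := s.RT_neg _ s.RT_one

theorem sub_mem_L2 {x y : U} (hx : x ∈ s.L2) (hy : y ∈ s.L2) : x - y ∈ s.L2 := by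
  rw [show x - y = x + (-1) * y by ring]
  exact s.add_mem_L2 hx (s.RT_mul_mem_L2 s.neg_one_mem_RT hy)

theorem zero_mem_L2 : (0 : U) ∈ s.L2 := ⟨s.L1_zero, by simpa using s.L1_zero⟩

theorem mem_L2_of_le {x y : U} (hx : 0 ≤ x) (hxy : x ≤ y) (hy : y ∈ s.L2) : x ∈ s.L2 :=
  ⟨s.mem_L1_of_le hx hxy hy.1,
    s.mem_L1_of_le (s.mul_self_nonneg x) (mul_le_mul hxy hxy hx (hx.trans hxy)) hy.2⟩

theorem posPart_mem_L2 {x : U} (hx : x ∈ s.L2) : x⁺ ∈ s.L2 := by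
  refine ⟨s.L1_ideal _ x hx.1 ?_, s.mem_L1_of_le (s.mul_self_nonneg _) ?_ hx.2⟩
  · rw [abs_of_nonneg (posPart_nonneg x)]
    exact sup_le (le_abs_self x) (abs_nonneg x)
  · rw [s.mul_self_eq_posPart_add_negPart x]
    exact le_add_of_nonneg_right (s.mul_self_nonneg _)

theorem sup_mem_L2 {x y : U} (hx : x ∈ s.L2) (hy : y ∈ s.L2) : x ⊔ y ∈ s.L2 := by
  rw [sup_eq_add_posPart_sub]
  exact s.add_mem_L2 hy (s.posPart_mem_L2 (s.sub_mem_L2 hx hy))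

theorem RT_sub_mem {x y : U} (hx : x ∈ s.RT) (hy : y ∈ s.RT) : x - y ∈ s.RT := by
  rw [sub_eq_add_neg]; exact s.RT_add _ hx _ (s.RT_neg _ hy)

/-- For a set decreasing to `0` in `L²(T)`, order continuity of `T` in the form of an estimate
whose error term is absorbed by the Archimedean property. -/
theorem nonpos_of_forall_le_T_mul {D : Set U} {w c K : U} (hD : D.Nonempty)
    (hdir : DirectedOn (· ≥ ·) D) (hD0 : ∀ u ∈ D, 0 ≤ u ∧ u ≤ w) (hw : w ∈ s.L2)
    (hglb : IsGLB D 0)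
    (h : ∀ u ∈ D, ∀ n : ℕ, 0 < n → n * c ≤ K + (2 * n + n * n) * s.T (w * u)) : c ≤ 0 := by
  have hw0 : 0 ≤ w := hD.elim fun u hu => (hD0 u hu).1.trans (hD0 u hu).2
  have hglb' := s.isGLB_mul_image hD0 hglb hw0
  have hT := s.T_ordCont ((fun u => w * u) '' D)
    (by rintro _ ⟨u, hu, rfl⟩
        exact s.mul_mem_L1 hw (s.mem_L2_of_le (hD0 u hu).1 (hD0 u hu).2 hw))
    (hD.image _)
    (by rintro _ ⟨u, hu, rfl⟩ _ ⟨v, hv, rfl⟩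
        obtain ⟨x, hx, hxu, hxv⟩ := hdir u hu v hv
        exact ⟨_, ⟨x, hx, rfl⟩, mul_le_mul_of_nonneg_left hxu hw0,
          mul_le_mul_of_nonneg_left hxv hw0⟩)
    (by rintro _ ⟨u, hu, rfl⟩; exact _root_.mul_nonneg hw0 (hD0 u hu).1)
    (hglb'.csInf_eq (hD.image _))
  refine nonpos_of_forall_natCast_mul_le (c := K) fun n hn => ?_
  obtain ⟨t, -, ht, h1⟩ := s.exists_natCast_mul_eq_one (n := 2 * n + n * n) (by positivity)
  push_cast at h1
  have h2 : t * (n * c - K) ≤ 0 := by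
    rw [← hT]
    refine le_csInf ((hD.image _).image _) ?_
    rintro _ ⟨_, ⟨u, hu, rfl⟩, rfl⟩
    linear_combination t * h u hu n hn + s.T (w * u) * h1
  have hn0 : (0 : U) ≤ 2 * n + n * n := by
    have := Nat.cast_nonneg (α := U) (2 * n + n * n)
    push_cast at this
    exact this
  linear_combination _root_.mul_nonneg hn0 (sub_nonneg.2 h2) - (n * c - K) * h1

/-! ### The quadratic functional -/

/-- The quadratic functional `g ↦ T(g²) - 2 F(g)` whose minimizer represents `F`. -/
def energy (F : U → U) (g : U) : U := s.T (g * g) - 2 * F g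

/-- `F` is additive and `R(T)`-homogeneous with values in `R(T)`, and its energy is bounded
below by `-K`. -/
structure EnergyBounded (F : U → U) (K : U) : Prop where
  mem : ∀ f ∈ s.L2, F f ∈ s.RT
  add : ∀ f ∈ s.L2, ∀ g ∈ s.L2, F (f + g) = F f + F g
  smul : ∀ r ∈ s.RT, ∀ f ∈ s.L2, F (r * f) = r * F f
  bound : ∀ f ∈ s.L2, 2 * F f ≤ K + s.T (f * f)

namespace EnergyBounded

variable {s} {F : U → U} {K : U}

theorem bound_mul (hF : s.EnergyBounded F K) {r f : U} (hr : r ∈ s.RT) (hf : f ∈ s.L2) :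
    2 * (r * F f) ≤ K + r * r * s.T (f * f) := by
  have h := hF.bound _ (s.RT_mul_mem_L2 hr hf)
  rwa [hF.smul r hr f hf, show r * f * (r * f) = r * r * (f * f) by ring,
    s.T_avg _ (s.RT_mul _ hr _ hr) _ hf.2] at h

theorem map_zero (hF : s.EnergyBounded F K) : F 0 = 0 := by
  simpa using hF.smul 0 s.RT_zero 0 s.zero_mem_L2

theorem energy_zero (hF : s.EnergyBounded F K) : s.energy F 0 = 0 := by
  simp [energy, hF.map_zero, s.T_fix 0 s.RT_zero]

theorem energy_add_mul (hF : s.EnergyBounded F K) {r x v : U} (hr : r ∈ s.RT) (hx : x ∈ s.L2)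
    (hv : v ∈ s.L2) : s.energy F (x + r * v) =
      s.energy F x + 2 * r * s.T (x * v) + r * r * s.T (v * v) - 2 * r * F v := by
  have hxv := s.mul_mem_L1 hx hv
  have h1 := s.L1_module r hr _ hxv
  have h2 := s.L1_module _ (s.RT_mul _ hr _ hr) _ hv.2
  unfold energy
  rw [hF.add _ hx _ (s.RT_mul_mem_L2 hr hv), hF.smul r hr v hv,
    show (x + r * v) * (x + r * v) = x * x + r * (x * v) + (r * (x * v) + r * r * (v * v)) by ring,
    s.T_add _ (s.L1_add _ hx.2 _ h1) _ (s.L1_add _ h1 _ h2), s.T_add _ hx.2 _ h1,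
    s.T_add _ h1 _ h2, s.T_avg r hr _ hxv, s.T_avg _ (s.RT_mul _ hr _ hr) _ hv.2]
  ring

theorem energy_add (hF : s.EnergyBounded F K) {x v : U} (hx : x ∈ s.L2) (hv : v ∈ s.L2) :
    s.energy F (x + v) = s.energy F x + 2 * s.T (x * v) + s.T (v * v) - 2 * F v := by
  have h := hF.energy_add_mul s.RT_one hx hv
  simpa using h

theorem energy_sub (hF : s.EnergyBounded F K) {x v : U} (hx : x ∈ s.L2) (hv : v ∈ s.L2) :
    s.energy F (x - v) = s.energy F x - 2 * s.T (x * v) + s.T (v * v) + 2 * F v := by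
  have h := hF.energy_add_mul s.neg_one_mem_RT hx hv
  rw [show x + -1 * v = x - v by ring] at h
  rw [h]
  ring

/-- The energy is a modular function on the lattice `L²(T)`. -/
theorem energy_sup_add_energy_inf (hF : s.EnergyBounded F K) {g h : U} (hg : g ∈ s.L2)
    (hh : h ∈ s.L2) :
    s.energy F (g ⊔ h) + s.energy F (g ⊓ h) = s.energy F g + s.energy F h := by
  have hd := s.sub_mem_L2 hg hh
  have hP := s.posPart_mem_L2 hd
  have h1 : g * (g - h)⁺ - h * (g - h)⁺ = (g - h)⁺ * (g - h)⁺ := by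
    linear_combination -(g - h)⁺ * posPart_sub_negPart (g - h) - s.posPart_mul_negPart (g - h)
  have h2 := s.T_sub (s.mul_mem_L1 hg hP) (s.mul_mem_L1 hh hP)
  rw [h1] at h2
  rw [sup_eq_add_posPart_sub, inf_eq_sub_posPart_sub, hF.energy_add hh hP, hF.energy_sub hg hP]
  linear_combination 2 * h2

theorem energy_mem (hF : s.EnergyBounded F K) {g : U} (hg : g ∈ s.L2) : s.energy F g ∈ s.RT := by
  refine s.RT_sub_mem (s.T_mem _ hg.2) (s.RT_mul _ ?_ _ (hF.mem g hg))
  exact_mod_cast s.natCast_mem_RT 2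

theorem T_mul_self_le (hF : s.EnergyBounded F K) {g : U} (hg : g ∈ s.L2)
    (h : s.energy F g ≤ 0) : s.T (g * g) ≤ 4 * K := by
  obtain ⟨t, ht, ht0, h1⟩ := s.exists_natCast_mul_eq_one two_pos
  push_cast at h1
  have h2 := hF.bound_mul ht hg
  unfold energy at h
  linear_combination h + h + h2 + h2 + h2 + h2 - (4 * F g - (2 * t + 1) * s.T (g * g)) * h1

/-- The positive elements of `L²(T)` whose energy is least among the elements below them. -/
def lowerMinimal (s : CESetup U) (F : U → U) : Set U :=
  {g | g ∈ s.L2 ∧ 0 ≤ g ∧ ∀ h, 0 ≤ h → h ≤ g → s.energy F g ≤ s.energy F h}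

theorem energy_sup_le (hF : s.EnergyBounded F K) {g h : U} (hg : g ∈ lowerMinimal s F)
    (hh : h ∈ s.L2) (hh0 : 0 ≤ h) : s.energy F (h ⊔ g) ≤ s.energy F h := by
  have h1 := hF.energy_sup_add_energy_inf hh hg.1
  have h2 := hg.2.2 (h ⊓ g) (le_inf hh0 hg.2.1) inf_le_right
  linear_combination h1 + h2

theorem zero_mem_lowerMinimal (s : CESetup U) (F : U → U) : 0 ∈ lowerMinimal s F :=
  ⟨s.zero_mem_L2, le_rfl, fun _ h0 h1 => (congrArg _ (le_antisymm h0 h1)).le⟩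

theorem sup_mem_lowerMinimal (hF : s.EnergyBounded F K) {g₁ g₂ : U}
    (h₁ : g₁ ∈ lowerMinimal s F) (h₂ : g₂ ∈ lowerMinimal s F) : g₁ ⊔ g₂ ∈ lowerMinimal s F := by
  have hL := s.sup_mem_L2 h₁.1 h₂.1
  refine ⟨hL, h₁.2.1.trans le_sup_left, fun h h0 hle => ?_⟩
  have hh := s.mem_L2_of_le h0 hle hL
  have e1 := hF.energy_sup_le h₁ hh h0
  have e2 := hF.energy_sup_le h₂ (s.sup_mem_L2 hh h₁.1) (h0.trans le_sup_left)
  rw [sup_assoc, sup_eq_right.2 hle] at e2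
  exact e2.trans e1

theorem exists_isGreatest_lowerMinimal (hF : s.EnergyBounded F K) :
    ∃ a, IsGreatest (lowerMinimal s F) a := by
  set S := lowerMinimal s F with hS
  have hne : S.Nonempty := ⟨0, zero_mem_lowerMinimal s F⟩
  have hdir : DirectedOn (· ≤ ·) S := fun x hx y hy =>
    ⟨x ⊔ y, hF.sup_mem_lowerMinimal hx hy, le_sup_left, le_sup_right⟩
  have hT2 : ∀ g ∈ S, s.T (g * g) ≤ 4 * K := fun g hg => by
    refine hF.T_mul_self_le hg.1 ?_
    rw [← hF.energy_zero]
    exact hg.2.2 0 le_rfl hg.2.1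
  have hT1 : ∀ g ∈ S, s.T g ≤ 4 * K + 1 := fun g hg => by
    have h1 : g ≤ g * g + 1 := by
      linear_combination s.mul_self_nonneg (g - 1) + hg.2.1
    have h2 := s.T_mono hg.1.1 (s.L1_add _ hg.1.2 _ s.L1_one) h1
    rw [s.T_add _ hg.1.2 _ s.L1_one, s.T_one] at h2
    exact h2.trans (by gcongr; exact hT2 g hg)
  obtain ⟨hbdd, haL1⟩ := s.T_univComplete S (fun g hg => hg.1.1) hne hdir (fun g hg => hg.2.1)
    ⟨_, hT1⟩
  set a := sSup S with ha
  have hga : ∀ g ∈ S, g ≤ a := fun g hg => le_csSup hbdd hg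
  have ha0 : 0 ≤ a := hga 0 (zero_mem_lowerMinimal s F)
  obtain ⟨hbdd', hbL1⟩ := s.T_univComplete ((fun g => g * g) '' S)
    (by rintro _ ⟨g, hg, rfl⟩; exact hg.1.2) (hne.image _)
    (by rintro _ ⟨g, hg, rfl⟩ _ ⟨h, hh, rfl⟩
        exact ⟨_, ⟨g ⊔ h, hF.sup_mem_lowerMinimal hg hh, rfl⟩,
          mul_le_mul le_sup_left le_sup_left hg.2.1 (hg.2.1.trans le_sup_left),
          mul_le_mul le_sup_right le_sup_right hh.2.1 (hh.2.1.trans le_sup_right)⟩)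
    (by rintro _ ⟨g, hg, rfl⟩; exact s.mul_self_nonneg g)
    ⟨4 * K, by rintro _ ⟨g, hg, rfl⟩; exact hT2 g hg⟩
  set D := (fun g => a - g) '' S with hD
  have hD0 : ∀ u ∈ D, 0 ≤ u ∧ u ≤ a := by
    rintro _ ⟨g, hg, rfl⟩
    exact ⟨sub_nonneg.2 (hga g hg), sub_le_self _ hg.2.1⟩
  have hDglb : IsGLB D 0 := by
    refine ⟨fun u hu => (hD0 u hu).1, fun c hc => ?_⟩
    have h1 : a ≤ a - c := csSup_le hne fun g hg => by
      have h2 : c ≤ a - g := hc ⟨g, hg, rfl⟩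
      linear_combination h2
    linear_combination h1
  have hDdir : DirectedOn (· ≥ ·) D := by
    rintro _ ⟨g, hg, rfl⟩ _ ⟨h, hh, rfl⟩
    exact ⟨_, ⟨g ⊔ h, hF.sup_mem_lowerMinimal hg hh, rfl⟩, sub_le_sub_left le_sup_left _,
      sub_le_sub_left le_sup_right _⟩
  have haa : a * a ≤ sSup ((fun g => g * g) '' S) := by
    rw [← sub_nonpos]
    refine (s.isGLB_mul_image hD0 hDglb (add_nonneg ha0 ha0)).2 ?_
    rintro _ ⟨_, ⟨g, hg, rfl⟩, rfl⟩
    have h1 : g * g ≤ sSup ((fun g => g * g) '' S) := le_csSup hbdd' ⟨g, hg, rfl⟩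
    have h2 := s.mul_self_nonneg (a - g)
    linear_combination h1 + h2
  have haL2 : a ∈ s.L2 := ⟨haL1, s.mem_L1_of_le (s.mul_self_nonneg a) haa hbL1⟩
  refine ⟨a, ⟨haL2, ha0, fun h h0 hle => ?_⟩, hga⟩
  have hh := s.mem_L2_of_le h0 hle haL2
  rw [← sub_nonpos]
  refine s.nonpos_of_forall_le_T_mul (K := K) (hne.image _) hDdir hD0 haL2 hDglb ?_
  rintro _ ⟨g, hg, rfl⟩ n hn
  have hn0 : (0 : U) ≤ n := Nat.cast_nonneg n
  have hx := s.sup_mem_L2 hh hg.1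
  have hv := s.sub_mem_L2 haL2 hx
  have hug := s.sub_mem_L2 haL2 hg.1
  have hv0 : 0 ≤ a - h ⊔ g := sub_nonneg.2 (sup_le hle (hga g hg))
  have hvu : a - h ⊔ g ≤ a - g := sub_le_sub_left le_sup_right _
  have e1 := hF.energy_sup_le hg hh h0
  have e2 := hF.energy_sub haL2 hv
  rw [sub_sub_cancel] at e2
  have e3 := hF.bound_mul (s.RT_neg _ (s.natCast_mem_RT n)) hv
  have e4 := s.T_mono (s.mul_mem_L1 haL2 hv) (s.mul_mem_L1 haL2 hug)
    (mul_le_mul_of_nonneg_left hvu ha0)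
  have e5 := s.T_mono hv.2 (s.mul_mem_L1 haL2 hug)
    (mul_le_mul (sub_le_self _ (h0.trans le_sup_left)) hvu hv0 ha0)
  have e6 := s.T_pos _ hv.2 (s.mul_self_nonneg _)
  have e7 := _root_.mul_nonneg hn0 e6
  have e8 := mul_le_mul_of_nonneg_left e1 hn0
  have e9 := mul_le_mul_of_nonneg_left e4 hn0
  have e10 := mul_le_mul_of_nonneg_left e5 (_root_.mul_nonneg hn0 hn0)
  linear_combination e8 + e7 + e3 + e9 + e9 + e10 - (n : U) * e2

/-- Below any `h ≥ a` there is some `x ≥ a` of no larger energy such that no element of `[a, x]`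
other than `x` has energy at most that of `x`. -/
theorem exists_minimal_energy (hF : s.EnergyBounded F K) {a h : U} (ha0 : 0 ≤ a) (hah : a ≤ h)
    (hh : h ∈ s.L2) : ∃ x, a ≤ x ∧ x ≤ h ∧ s.energy F x ≤ s.energy F h ∧
      ∀ y, a ≤ y → y ≤ x → s.energy F y ≤ s.energy F x → y = x := by
  let X := {x : U // (a ≤ x ∧ x ≤ h) ∧ s.energy F x ≤ s.energy F h}
  let r : X → X → Prop := fun x y => y.1 ≤ x.1 ∧ s.energy F y.1 ≤ s.energy F x.1
  have : Nonempty X := ⟨⟨h, ⟨hah, le_rfl⟩, le_rfl⟩⟩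
  have hchain : ∀ C : Set X, IsChain r C → C.Nonempty → ∃ ub, ∀ x ∈ C, r x ub := by
    intro C hC hne
    have htot : ∀ p ∈ C, ∀ q ∈ C, r p q ∨ r q p := fun p hp q hq => by
      by_cases hpq : p = q
      · exact Or.inl (hpq ▸ ⟨le_rfl, le_rfl⟩)
      · exact hC hp hq hpq
    let P : Set U := Subtype.val '' C
    have hbdd : BddBelow P := ⟨a, by rintro _ ⟨p, -, rfl⟩; exact p.2.1.1⟩
    have hPne : P.Nonempty := hne.image _
    set z := sInf P with hz
    have hzp : ∀ p ∈ C, z ≤ p.1 := fun p hp => csInf_le hbdd ⟨p, hp, rfl⟩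
    have haz : a ≤ z := le_csInf hPne (by rintro _ ⟨p, -, rfl⟩; exact p.2.1.1)
    have hzh : z ≤ h := hne.elim fun p hp => (hzp p hp).trans p.2.1.2
    have hzL2 : z ∈ s.L2 := s.mem_L2_of_le (ha0.trans haz) hzh hh
    have hz0 : 0 ≤ z := ha0.trans haz
    have hh0 : 0 ≤ h := ha0.trans hah
    have hle : ∀ q ∈ C, s.energy F z ≤ s.energy F q.1 := by
      intro q hq
      rw [← sub_nonpos]
      let D : Set U := {u | ∃ p ∈ C, r q p ∧ u = p.1 - z}
      refine s.nonpos_of_forall_le_T_mul (D := D) (w := h) (K := K)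
        ⟨_, q, hq, ⟨le_rfl, le_rfl⟩, rfl⟩ ?_ ?_ hh ?_ ?_
      · rintro _ ⟨p, hp, hqp, rfl⟩ _ ⟨p', hp', hqp', rfl⟩
        rcases htot p hp p' hp' with hr | hr
        · exact ⟨_, ⟨p', hp', hqp', rfl⟩, sub_le_sub_right hr.1 _, le_rfl⟩
        · exact ⟨_, ⟨p, hp, hqp, rfl⟩, le_rfl, sub_le_sub_right hr.1 _⟩
      · rintro _ ⟨p, hp, -, rfl⟩
        exact ⟨sub_nonneg.2 (hzp p hp), (sub_le_self _ hz0).trans p.2.1.2⟩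
      · refine ⟨?_, fun c hc => ?_⟩
        · rintro _ ⟨p, hp, -, rfl⟩
          exact sub_nonneg.2 (hzp p hp)
        · have h1 : c + z ≤ z := by
            refine le_csInf hPne ?_
            rintro _ ⟨p, hp, rfl⟩
            rcases htot q hq p hp with hr | hr
            · exact le_sub_iff_add_le.1 (hc ⟨p, hp, hr, rfl⟩)
            · exact (le_sub_iff_add_le.1 (hc ⟨q, hq, ⟨le_rfl, le_rfl⟩, rfl⟩)).trans hr.1
          linear_combination h1
      · rintro _ ⟨p, hp, hqp, rfl⟩ n hn
        have hn0 : (0 : U) ≤ n := Nat.cast_nonneg n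
        have hu0 : 0 ≤ p.1 - z := sub_nonneg.2 (hzp p hp)
        have huh : p.1 - z ≤ h := (sub_le_self _ hz0).trans p.2.1.2
        have huL2 := s.mem_L2_of_le hu0 huh hh
        have e1 := hF.energy_add hzL2 huL2
        rw [add_sub_cancel] at e1
        have e2 := hF.bound_mul (s.natCast_mem_RT n) huL2
        have e3 := s.T_mono huL2.2 (s.mul_mem_L1 hh huL2) (mul_le_mul_of_nonneg_right huh hu0)
        have e4 := s.T_pos _ huL2.2 (s.mul_self_nonneg _)
        have e5 := s.T_pos _ (s.mul_mem_L1 hzL2 huL2) (_root_.mul_nonneg hz0 hu0)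
        have e6 := s.T_pos _ (s.mul_mem_L1 hh huL2) (_root_.mul_nonneg hh0 hu0)
        have f1 := mul_le_mul_of_nonneg_left hqp.2 hn0
        have f3 := mul_le_mul_of_nonneg_left e3 (_root_.mul_nonneg hn0 hn0)
        have f4 := _root_.mul_nonneg hn0 e4
        have f5 := _root_.mul_nonneg hn0 e5
        have f6 := _root_.mul_nonneg hn0 e6
        linear_combination f1 + e2 + f3 + f4 + f5 + f5 + f6 + f6 - (n : U) * e1
    exact ⟨⟨z, ⟨haz, hzh⟩, hne.elim fun p hp => (hle p hp).trans p.2.2⟩,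
      fun x hx => ⟨hzp x hx, hle x hx⟩⟩
  obtain ⟨m, hm⟩ := exists_maximal_of_nonempty_chains_bounded hchain
    (fun h1 h2 => ⟨h2.1.trans h1.1, h2.2.trans h1.2⟩)
  exact ⟨m.1, m.2.1.1, m.2.1.2, m.2.2, fun y hay hym hy => le_antisymm hym
    (hm ⟨y, ⟨hay, hym.trans m.2.1.2⟩, hy.trans m.2.2⟩ ⟨hym, hy⟩).1⟩

theorem energy_le_of_minimal (hF : s.EnergyBounded F K) {a x y : U} (hx : x ∈ s.L2) (ha0 : 0 ≤ a)
    (hmin : ∀ y, a ≤ y → y ≤ x → s.energy F y ≤ s.energy F x → y = x) (hay : a ≤ y)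
    (hyx : y ≤ x) : s.energy F x ≤ s.energy F y := by
  have hy := s.mem_L2_of_le (ha0.trans hay) hyx hx
  have hv := s.sub_mem_L2 hx hy
  set v := x - y with hvdef
  have hv0 : 0 ≤ v := sub_nonneg.2 hyx
  set d := s.energy F x - s.energy F y with hd
  have hdRT : d ∈ s.RT := s.RT_sub_mem (hF.energy_mem hx) (hF.energy_mem hy)
  have hposRT : d⁺ ∈ s.RT := s.RT_sup _ hdRT _ s.RT_zero
  set p := d⁺ ⊓ 1 with hp
  have hpRT : p ∈ s.RT := by
    have h1 := s.RT_neg _ (s.RT_sup _ (s.RT_neg _ hposRT) _ s.neg_one_mem_RT)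
    rwa [← neg_inf, neg_neg] at h1
  have hp0 : 0 ≤ p := le_inf (posPart_nonneg d) s.one_pos.le
  have hp1 : p ≤ 1 := inf_le_right
  have hpneg : p * d⁻ = 0 := by
    refine le_antisymm ?_ (_root_.mul_nonneg hp0 (negPart_nonneg d))
    rw [← s.posPart_mul_negPart d]
    exact mul_le_mul_of_nonneg_right inf_le_left (negPart_nonneg d)
  have hpd : p * d = p * d⁺ := by
    linear_combination -p * posPart_sub_negPart d - hpneg
  have hpd0 : 0 ≤ p * d := hpd ▸ _root_.mul_nonneg hp0 (posPart_nonneg d)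
  have e1 := hF.energy_add_mul (s.RT_neg _ hpRT) hx hv
  have e2 := hF.energy_sub hx hv
  rw [show x - v = y by rw [hvdef]; ring] at e2
  have e3 : 0 ≤ p * (1 - p) * s.T (v * v) :=
    _root_.mul_nonneg (_root_.mul_nonneg hp0 (sub_nonneg.2 hp1))
      (s.T_pos _ hv.2 (s.mul_self_nonneg v))
  have e4 := hmin (x + -p * v)
    (by have h1 : p * v ≤ 1 * v := mul_le_mul_of_nonneg_right hp1 hv0
        linear_combination h1 + hay + hvdef)
    (by linear_combination _root_.mul_nonneg hp0 hv0)
    (by linear_combination e1 + e3 + hpd0 - p * e2 + p * hd)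
  have hpv : p * v = 0 := by linear_combination -e4
  have hTxv : p * s.T (x * v) = 0 := by
    rw [← s.T_avg p hpRT _ (s.mul_mem_L1 hx hv), show p * (x * v) = x * (p * v) by ring, hpv,
      mul_zero, s.T_fix 0 s.RT_zero]
  have hTvv : p * s.T (v * v) = 0 := by
    rw [← s.T_avg p hpRT _ hv.2, show p * (v * v) = v * (p * v) by ring, hpv,
      mul_zero, s.T_fix 0 s.RT_zero]
  have hFv : p * F v = 0 := by
    rw [← hF.smul p hpRT v hv, hpv, hF.map_zero]
  have hpd' : p * d = 0 := by
    linear_combination p * hd - p * e2 + 2 * hTxv - hTvv - 2 * hFv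
  have hpp : p * p = 0 := by
    refine le_antisymm ?_ (s.mul_self_nonneg p)
    rw [← hpd', hpd]
    exact mul_le_mul_of_nonneg_left inf_le_left hp0
  have hpz := s.eq_zero_of_mul_self_eq_zero hp0 hpp
  have h2 := s.one_weak _ (posPart_nonneg d) hpz
  exact sub_nonpos.1 (posPart_eq_zero.1 h2)

theorem exists_forall_energy_le (hF : s.EnergyBounded F K) :
    ∃ a ∈ s.L2, 0 ≤ a ∧ ∀ h ∈ s.L2, 0 ≤ h → s.energy F a ≤ s.energy F h := by
  obtain ⟨a, ha, hmax⟩ := hF.exists_isGreatest_lowerMinimal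
  refine ⟨a, ha.1, ha.2.1, fun h hh h0 => ?_⟩
  have hL := s.sup_mem_L2 hh ha.1
  obtain ⟨x, hax, hxh, hex, hmin⟩ := hF.exists_minimal_energy ha.2.1 le_sup_right hL
  have hx := s.mem_L2_of_le (ha.2.1.trans hax) hxh hL
  have hxS : x ∈ lowerMinimal s F := by
    refine ⟨hx, ha.2.1.trans hax, fun y hy0 hyx => ?_⟩
    have hy := s.mem_L2_of_le hy0 hyx hx
    exact (hF.energy_le_of_minimal hx ha.2.1 hmin le_sup_right (sup_le hyx hax)).trans
      (hF.energy_sup_le ha hy hy0)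
  have hxa : x = a := le_antisymm (hmax hxS) hax
  rw [← hxa]
  exact hex.trans (hF.energy_sup_le ha hh h0)

theorem le_T_mul_of_energy_le (hF : s.EnergyBounded F K) {a h : U} (ha : a ∈ s.L2) (hh : h ∈ s.L2)
    (hle : ∀ t ∈ s.RT, 0 ≤ t → s.energy F a ≤ s.energy F (a + t * h)) :
    F h ≤ s.T (a * h) := by
  rw [← sub_nonpos]
  refine s.le_of_natCast_mul_le two_pos ?_
  rw [mul_zero]
  refine nonpos_of_forall_natCast_mul_le (c := s.T (h * h)) fun n hn => ?_
  obtain ⟨t, ht, ht0, h1⟩ := s.exists_natCast_mul_eq_one hn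
  have hn0 : (0 : U) ≤ n := Nat.cast_nonneg n
  have h2 := hle t ht ht0
  rw [hF.energy_add_mul ht ha hh] at h2
  have h3 := mul_le_mul_of_nonneg_left h2 (_root_.mul_nonneg hn0 hn0)
  push_cast
  linear_combination h3 + ((n * t + 1) * s.T (h * h) + 2 * n * (s.T (a * h) - F h)) * h1

/-- The representation of positive functionals. -/
theorem exists_eq_T_mul_of_nonneg (hF : s.EnergyBounded F K)
    (hpos : ∀ h ∈ s.L2, 0 ≤ h → 0 ≤ F h) : ∃ a ∈ s.L2, ∀ h ∈ s.L2, F h = s.T (a * h) := by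
  obtain ⟨a, ha, -, hmin⟩ := hF.exists_forall_energy_le
  have hall : ∀ h ∈ s.L2, s.energy F a ≤ s.energy F h := fun h hh => by
    have hp := s.posPart_mem_L2 hh
    have hq : h⁻ ∈ s.L2 := by
      rw [show h⁻ = h⁺ - h by linear_combination -posPart_sub_negPart h]
      exact s.sub_mem_L2 hp hh
    have e1 := hmin _ hp (posPart_nonneg h)
    have e2 := hF.energy_sub hp hq
    rw [posPart_sub_negPart, s.posPart_mul_negPart, s.T_fix 0 s.RT_zero] at e2
    have e3 := s.T_pos _ hq.2 (s.mul_self_nonneg _)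
    have e4 := hpos _ hq (negPart_nonneg h)
    linear_combination e1 + e3 + e4 + e4 - e2
  have hle : ∀ h ∈ s.L2, F h ≤ s.T (a * h) := fun h hh =>
    hF.le_T_mul_of_energy_le ha hh fun t ht _ =>
      hall _ (s.add_mem_L2 ha (s.RT_mul_mem_L2 ht hh))
  refine ⟨a, ha, fun h hh => le_antisymm (hle h hh) ?_⟩
  have h1 := hle _ (s.RT_mul_mem_L2 s.neg_one_mem_RT hh)
  rw [hF.smul _ s.neg_one_mem_RT h hh, show a * (-1 * h) = -1 * (a * h) by ring,
    s.T_avg _ s.neg_one_mem_RT _ (s.mul_mem_L1 ha hh)] at h1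
  linear_combination h1

theorem T_mul_sub (hF : s.EnergyBounded F K) {a : U} (ha : a ∈ s.L2) :
    s.EnergyBounded (fun h => s.T (a * h) - F h) (2 * (K + s.T (a * a))) where
  mem f hf := s.RT_sub_mem (s.T_mem _ (s.mul_mem_L1 ha hf)) (hF.mem f hf)
  add f hf g hg := by
    rw [hF.add f hf g hg, mul_add, s.T_add _ (s.mul_mem_L1 ha hf) _ (s.mul_mem_L1 ha hg)]
    ring
  smul r hr f hf := by
    rw [hF.smul r hr f hf, show a * (r * f) = r * (a * f) by ring,
      s.T_avg r hr _ (s.mul_mem_L1 ha hf)]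
    ring
  bound f hf := by
    obtain ⟨t, ht, ht0, ht1⟩ := s.exists_natCast_mul_eq_one two_pos
    push_cast at ht1
    have h1 := hF.bound_mul (s.RT_neg _ ht) hf
    have hg := s.RT_mul_mem_L2 ht hf
    have h2 := s.T_pos _ (s.sub_mem_L2 ha hg).2 (s.mul_self_nonneg _)
    have hag := s.mul_mem_L1 ha hg
    rw [show (a - t * f) * (a - t * f) = a * a - a * (t * f) - (a * (t * f) - t * f * (t * f)) by
        ring, s.T_sub (s.sub_mem_L1 ha.2 hag) (s.sub_mem_L1 hag hg.2), s.T_sub ha.2 hag,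
      s.T_sub hag hg.2, show a * (t * f) = t * (a * f) by ring,
      show t * f * (t * f) = t * t * (f * f) by ring, s.T_avg t ht _ (s.mul_mem_L1 ha hf),
      s.T_avg _ (s.RT_mul _ ht _ ht) _ hf.2] at h2
    linear_combination h1 + h1 + h2 + h2 +
      ((2 * t + 1) * s.T (f * f) - 2 * (s.T (a * f) - F f)) * ht1

theorem exists_eq_T_mul (hF : s.EnergyBounded F K) :
    ∃ y ∈ s.L2, ∀ g ∈ s.L2, F g = s.T (g * y) := by
  obtain ⟨a, ha, ha0, hmin⟩ := hF.exists_forall_energy_le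
  obtain ⟨b, hb, hQ⟩ := (hF.T_mul_sub ha).exists_eq_T_mul_of_nonneg fun h hh h0 =>
    sub_nonneg.2 <| hF.le_T_mul_of_energy_le ha hh fun t ht ht0 =>
      hmin _ (s.add_mem_L2 ha (s.RT_mul_mem_L2 ht hh)) (add_nonneg ha0 (_root_.mul_nonneg ht0 h0))
  refine ⟨a - b, s.sub_mem_L2 ha hb, fun g hg => ?_⟩
  rw [show g * (a - b) = a * g - b * g by ring,
    s.T_sub (s.mul_mem_L1 ha hg) (s.mul_mem_L1 hb hg)]
  linear_combination -hQ g hg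

end EnergyBounded

theorem IsStronglyBounded.exists_energyBounded {s : CESetup U} {F : U → U} (hlin : s.IsTLinear F)
    (hbd : s.IsStronglyBounded F) : ∃ K, s.EnergyBounded F K := by
  obtain ⟨k, -, -, hk⟩ := hbd
  refine ⟨k * k, hlin.1, hlin.2.1, hlin.2.2.1, fun f hf => ?_⟩
  have h1 := (le_abs_self _).trans (hk f hf)
  have h2 : s.norm2 f * s.norm2 f = s.T (f * f) :=
    s.sqrt_sq _ (s.T_pos _ hf.2 (s.mul_self_nonneg f))
  linear_combination h1 + h1 + s.mul_self_nonneg (k - s.norm2 f) + h2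

end

end CESetup

/-- Riesz-Frechet representation theorem in Riesz spaces: for each
`𝔣 ∈ Ê` there exists `y(𝔣) ∈ E := L²(T)` such that `𝔣(g) = T(g y(𝔣))` for all
`g ∈ E`, i.e. `𝔣 = T_{y(𝔣)}`. -/
theorem ce_riesz_frechet {U : Type*} [CommRing U] [ConditionallyCompleteLattice U]
    [CovariantClass U U (· + ·) (· ≤ ·)] [Module ℝ U] [PosSMulMono ℝ U]
    (s : CESetup U) (F : U → U) (hlin : s.IsTLinear F)
    (hbd : s.IsStronglyBounded F) :
    ∃ y ∈ s.L2, ∀ g ∈ s.L2, F g = s.T (g * y) := by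
  have : IsOrderedAddMonoid U :=
    { add_le_add_left := fun _ _ h c => add_le_add_left h c }
  have : ZeroLEOneClass U := ⟨s.one_pos.le⟩
  have : IsOrderedRing U := IsOrderedRing.of_mul_nonneg s.mul_nonneg
  obtain ⟨K, hK⟩ := hbd.exists_energyBounded hlin
  exact hK.exists_eq_T_mul
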